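/- There is no real analytic function g defined on a neighborhood of 0 in [0,∞) with g(0) = 0 satisfying g'(t) = exp(g(g(t))) for all t in its domain, whose Taylor series at 0 has positive radius of convergence; equivalently, the formal power series solution of g' = exp(g∘g), g(0) = 0, has radius of convergence zero. -/

import Mathlib

open Polynomial

/-- The truncation `∑_{n < N} bₙ Xⁿ` of the power series with coefficients `b`. -/
noncomputable def seriesTrunc (b : ℕ → ℝ) (N : ℕ) : ℝ[X] :=
  ∑ n ∈ Finset.range N, C (b n) * X ^ n

/-- The antiderivative of `seriesTrunc b N` vanishing at `0`. -/
noncomputable def primTrunc (b : ℕ → ℝ) (N : ℕ) : ℝ[X] :=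
  ∑ n ∈ Finset.range N, C (b n / (n + 1)) * X ^ (n + 1)

/-- With `u` the series of coefficients `b` and `g` its antiderivative, the truncated version of
`u² · (u ∘ g)`. -/
noncomputable def rhsTrunc (b : ℕ → ℝ) (N : ℕ) : ℝ[X] :=
  seriesTrunc b N ^ 2 * (seriesTrunc b N).comp (primTrunc b N)

theorem coeff_seriesTrunc (b : ℕ → ℝ) (N k : ℕ) :
    (seriesTrunc b N).coeff k = if k < N then b k else 0 := by
  simp [seriesTrunc, finsetSum_coeff, coeff_X_pow]

theorem coeff_primTrunc_zero (b : ℕ → ℝ) (N : ℕ) : (primTrunc b N).coeff 0 = 0 := by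
  simp [primTrunc, finsetSum_coeff]

theorem coeff_primTrunc_succ (b : ℕ → ℝ) (N k : ℕ) :
    (primTrunc b N).coeff (k + 1) = if k < N then b k / (k + 1) else 0 := by
  simp [primTrunc, finsetSum_coeff, coeff_X_pow]

theorem comp_seriesTrunc (b : ℕ → ℝ) (N : ℕ) (p : ℝ[X]) :
    (seriesTrunc b N).comp p = ∑ n ∈ Finset.range N, C (b n) * p ^ n := by
  simp [seriesTrunc, comp, eval₂_finsetSum]

theorem eval_seriesTrunc (b : ℕ → ℝ) (N : ℕ) (x : ℝ) :
    (seriesTrunc b N).eval x = ∑ n ∈ Finset.range N, b n * x ^ n := by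
  simp [seriesTrunc, eval_finsetSum]

theorem eval_primTrunc (b : ℕ → ℝ) (N : ℕ) (x : ℝ) :
    (primTrunc b N).eval x = ∑ n ∈ Finset.range N, b n / (n + 1) * x ^ (n + 1) := by
  simp [primTrunc, eval_finsetSum]

theorem coeff_mul_nonneg {p q : ℝ[X]} (hp : ∀ k, 0 ≤ p.coeff k) (hq : ∀ k, 0 ≤ q.coeff k)
    (k : ℕ) : 0 ≤ (p * q).coeff k := by
  rw [coeff_mul]
  exact Finset.sum_nonneg fun i _ => mul_nonneg (hp _) (hq _)

theorem coeff_pow_nonneg {p : ℝ[X]} (hp : ∀ k, 0 ≤ p.coeff k) (n k : ℕ) :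
    0 ≤ (p ^ n).coeff k := by
  induction n generalizing k with
  | zero => rw [pow_zero, coeff_one]; split_ifs <;> simp
  | succ n ih => rw [pow_succ]; exact coeff_mul_nonneg ih hp k

theorem coeff_mul_le_coeff_mul {p q p' q' : ℝ[X]} (hp : ∀ k, 0 ≤ p.coeff k)
    (hq : ∀ k, 0 ≤ q.coeff k) (hpp : ∀ k, p.coeff k ≤ p'.coeff k)
    (hqq : ∀ k, q.coeff k ≤ q'.coeff k) (k : ℕ) : (p * q).coeff k ≤ (p' * q').coeff k := by
  rw [coeff_mul, coeff_mul]
  exact Finset.sum_le_sum fun i _ =>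
    mul_le_mul (hpp _) (hqq _) (hq _) ((hp _).trans (hpp _))

theorem coeff_pow_le_coeff_pow {p p' : ℝ[X]} (hp : ∀ k, 0 ≤ p.coeff k)
    (hpp : ∀ k, p.coeff k ≤ p'.coeff k) (n k : ℕ) : (p ^ n).coeff k ≤ (p' ^ n).coeff k := by
  induction n generalizing k with
  | zero => simp
  | succ n ih =>
    rw [pow_succ, pow_succ]
    exact coeff_mul_le_coeff_mul (coeff_pow_nonneg hp n) hp ih hpp k

theorem coeff_seriesTrunc_nonneg {b : ℕ → ℝ} {N : ℕ} (hb : ∀ n < N, 0 ≤ b n) (k : ℕ) :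
    0 ≤ (seriesTrunc b N).coeff k := by
  rw [coeff_seriesTrunc]
  split_ifs with h
  exacts [hb k h, le_rfl]

theorem coeff_primTrunc_nonneg {b : ℕ → ℝ} {N : ℕ} (hb : ∀ n < N, 0 ≤ b n) (k : ℕ) :
    0 ≤ (primTrunc b N).coeff k := by
  cases k with
  | zero => rw [coeff_primTrunc_zero]
  | succ k =>
    rw [coeff_primTrunc_succ]
    split_ifs with h
    exacts [div_nonneg (hb k h) (by positivity), le_rfl]

theorem coeff_comp_seriesTrunc_nonneg {b : ℕ → ℝ} {N : ℕ} (hb : ∀ n < N, 0 ≤ b n) {p : ℝ[X]}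
    (hp : ∀ k, 0 ≤ p.coeff k) (k : ℕ) : 0 ≤ ((seriesTrunc b N).comp p).coeff k := by
  rw [comp_seriesTrunc, finsetSum_coeff]
  refine Finset.sum_nonneg fun n hn => ?_
  rw [coeff_C_mul]
  exact mul_nonneg (hb n (Finset.mem_range.1 hn)) (coeff_pow_nonneg hp n k)

theorem coeff_rhsTrunc_mono {b : ℕ → ℝ} (hb : ∀ n, 0 ≤ b n) {M N : ℕ} (h : M ≤ N) (k : ℕ) :
    (rhsTrunc b M).coeff k ≤ (rhsTrunc b N).coeff k := by
  have hS : ∀ k, (seriesTrunc b M).coeff k ≤ (seriesTrunc b N).coeff k := fun k => by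
    rw [coeff_seriesTrunc, coeff_seriesTrunc]
    have := hb k
    split_ifs <;> first | omega | linarith
  have hP : ∀ k, (primTrunc b M).coeff k ≤ (primTrunc b N).coeff k := fun k => by
    cases k with
    | zero => rw [coeff_primTrunc_zero, coeff_primTrunc_zero]
    | succ k =>
      rw [coeff_primTrunc_succ, coeff_primTrunc_succ]
      have : 0 ≤ b k / (k + 1) := div_nonneg (hb k) (by positivity)
      split_ifs <;> first | omega | linarith
  have hS0 := fun N => coeff_seriesTrunc_nonneg (b := b) (N := N) fun n _ => hb n
  have hP0 := fun N => coeff_primTrunc_nonneg (b := b) (N := N) fun n _ => hb n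
  refine coeff_mul_le_coeff_mul (coeff_pow_nonneg (hS0 M) 2)
    (coeff_comp_seriesTrunc_nonneg (fun n _ => hb n) (hP0 M))
    (coeff_pow_le_coeff_pow (hS0 M) hS 2) (fun k => ?_) k
  simp only [comp_seriesTrunc, finsetSum_coeff, coeff_C_mul]
  calc _ ≤ ∑ n ∈ Finset.range M, b n * (primTrunc b N ^ n).coeff k :=
        Finset.sum_le_sum fun n _ =>
          mul_le_mul_of_nonneg_left (coeff_pow_le_coeff_pow (hP0 M) hP n k) (hb n)
    _ ≤ _ := Finset.sum_le_sum_of_subset_of_nonneg (Finset.range_mono h)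
        fun n _ _ => mul_nonneg (hb n) (coeff_pow_nonneg (hP0 N) n k)

/-- The recursion satisfied by the coefficients forces them to be at least `1`. -/
theorem one_le_of_coeff_rhsTrunc {b : ℕ → ℝ} (h0 : b 0 = 1)
    (hrec : ∀ N, ∀ k < N, (rhsTrunc b N).coeff k = (k + 1) * b (k + 1)) (n : ℕ) : 1 ≤ b n := by
  induction n using Nat.strong_induction_on with
  | _ n ih =>
  cases n with
  | zero => exact h0.ge
  | succ k =>
    have hb : ∀ n < k + 1, 0 ≤ b n := fun n hn => zero_le_one.trans (ih n hn)
    have hS := coeff_seriesTrunc_nonneg hb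
    have hP := coeff_primTrunc_nonneg hb
    have hle : ((seriesTrunc b (k + 1)) ^ 2 * 1).coeff k ≤ (rhsTrunc b (k + 1)).coeff k := by
      refine coeff_mul_le_coeff_mul (coeff_pow_nonneg hS 2) (fun j => ?_) (fun _ => le_rfl)
        (fun j => ?_) k
      · rw [coeff_one]; split_ifs <;> simp
      · rw [coeff_one]
        split_ifs with hj
        · subst hj
          rw [coeff_zero_eq_eval_zero, eval_comp, ← coeff_zero_eq_eval_zero,
            coeff_primTrunc_zero, ← coeff_zero_eq_eval_zero, coeff_seriesTrunc]
          simp [h0]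
        · exact coeff_comp_seriesTrunc_nonneg hb hP j
    have hsq : (k + 1 : ℝ) ≤ ((seriesTrunc b (k + 1)) ^ 2 * 1).coeff k := by
      rw [mul_one, sq, coeff_mul]
      have : ∑ _i ∈ Finset.HasAntidiagonal.antidiagonal k, (1 : ℝ) = k + 1 := by simp
      rw [← this]
      refine Finset.sum_le_sum fun i hi => ?_
      have hi := Finset.HasAntidiagonal.mem_antidiagonal.1 hi
      rw [coeff_seriesTrunc, coeff_seriesTrunc, if_pos (by omega), if_pos (by omega)]
      exact one_le_mul_of_one_le_of_one_le (ih _ (by omega)) (ih _ (by omega))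
    rw [hrec _ k k.lt_succ_self] at hle
    have : (0 : ℝ) < k + 1 := by positivity
    nlinarith

theorem bounded_of_coeff_rhsTrunc {b : ℕ → ℝ} (hb : ∀ n, 1 ≤ b n)
    (hrec : ∀ N, ∀ k < N, (rhsTrunc b N).coeff k = (k + 1) * b (k + 1))
    {x r K : ℝ} (hx : 0 < x) (hxr : x < r) (hK : ∀ n, b n * r ^ n ≤ K) :
    ∃ K', ∀ n, b n * (x + x ^ 2 / 2) ^ n ≤ K' := by
  have hb0 : ∀ n, 0 ≤ b n := fun n => zero_le_one.trans (hb n)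
  have hr : 0 < r := hx.trans hxr
  have hsum : Summable fun k : ℕ => (k + 1) * b (k + 1) * x ^ k := by
    have hq : ‖x / r‖ < 1 := by
      rw [Real.norm_of_nonneg (by positivity), div_lt_one hr]; exact hxr
    have h1 := summable_pow_mul_geometric_of_norm_lt_one 1 hq
    have h2 := summable_geometric_of_norm_lt_one hq
    refine Summable.of_nonneg_of_le (fun k => ?_) (fun k => ?_) ((h1.add h2).mul_left (K / r))
    · have := hb0 (k + 1)
      positivity
    · calc (k + 1) * b (k + 1) * x ^ k
          = (k + 1) * (b (k + 1) * r ^ (k + 1)) / r * (x / r) ^ k := by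
            rw [div_pow]; field_simp; ring
        _ ≤ (k + 1) * K / r * (x / r) ^ k := by gcongr; exact hK _
        _ = _ := by ring
  refine ⟨∑' k : ℕ, (k + 1) * b (k + 1) * x ^ k, fun n => ?_⟩
  set y := x + x ^ 2 / 2
  have hy : 0 ≤ y := by positivity
  set M := n + 2
  have hcoeff : ∀ k, (rhsTrunc b M).coeff k ≤ (k + 1) * b (k + 1) := fun k => by
    rw [← hrec (max M (k + 1)) k (by omega)]
    exact coeff_rhsTrunc_mono hb0 (le_max_left _ _) k
  have heval : (rhsTrunc b M).eval x ≤ ∑' k : ℕ, (k + 1) * b (k + 1) * x ^ k := by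
    rw [eval_eq_sum_range]
    refine (Finset.sum_le_sum fun k _ =>
      mul_le_mul_of_nonneg_right (hcoeff k) (by positivity)).trans
      (hsum.sum_le_tsum _ fun k _ => ?_)
    have := hb0 (k + 1)
    positivity
  have hP : y ≤ (primTrunc b M).eval x := by
    rw [eval_primTrunc]
    calc y ≤ ∑ n ∈ Finset.range 2, b n / (n + 1) * x ^ (n + 1) := by
          have h1 := hb 0
          have h2 := hb 1
          simp only [Finset.sum_range_succ, Finset.range_zero, Finset.sum_empty]
          norm_num
          simp only [y]
          nlinarith [sq_nonneg x]
      _ ≤ _ := Finset.sum_le_sum_of_subset_of_nonneg (Finset.range_mono (by omega))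
          fun n _ _ => by
            have := hb0 n
            positivity
  have hS : ∀ z, 0 ≤ z → 1 ≤ (seriesTrunc b M).eval z := fun z hz => by
    rw [eval_seriesTrunc]
    have := Finset.single_le_sum (f := fun n => b n * z ^ n) (s := Finset.range M)
      (fun n _ => mul_nonneg (hb0 n) (by positivity)) (Finset.mem_range.2 (by omega : 0 < M))
    have h1 := hb 0
    simp only [pow_zero, mul_one] at this
    linarith
  have hcomp : b n * y ^ n ≤ (seriesTrunc b M).eval ((primTrunc b M).eval x) := by
    rw [eval_seriesTrunc]
    have h1 := Finset.single_le_sum (f := fun n => b n * ((primTrunc b M).eval x) ^ n)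
      (s := Finset.range M) (fun n _ => mul_nonneg (hb0 n) (pow_nonneg (hy.trans hP) _))
      (Finset.mem_range.2 (by omega : n < M))
    exact (mul_le_mul_of_nonneg_left (pow_le_pow_left₀ hy hP n) (hb0 n)).trans h1
  refine le_trans ?_ heval
  rw [rhsTrunc, eval_mul, eval_pow, eval_comp]
  have h1 := hS x hx.le
  exact hcomp.trans (le_mul_of_one_le_left (zero_le_one.trans (hS _ (hy.trans hP)))
    (one_le_pow₀ h1))

theorem not_bounded_of_coeff_rhsTrunc {b : ℕ → ℝ} (h0 : b 0 = 1)
    (hrec : ∀ N, ∀ k < N, (rhsTrunc b N).coeff k = (k + 1) * b (k + 1))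
    {r : ℝ} (hr : 0 < r) (K : ℝ) : ¬ ∀ n, b n * r ^ n ≤ K := by
  intro hK
  have hb := one_le_of_coeff_rhsTrunc h0 hrec
  set S : Set ℝ := {s | 0 < s ∧ ∃ K, ∀ n, b n * s ^ n ≤ K}
  have hrS : r ∈ S := ⟨hr, K, hK⟩
  have hbdd : BddAbove S := by
    refine ⟨1, fun s hs => ?_⟩
    obtain ⟨hs, L, hL⟩ := hs
    by_contra! h
    obtain ⟨n, hn⟩ := pow_unbounded_of_one_lt L h
    have : s ^ n ≤ b n * s ^ n := le_mul_of_one_le_left (by positivity) (hb n)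
    linarith [hL n]
  set R := sSup S
  have hR : 0 < R := hr.trans_le (le_csSup hbdd hrS)
  obtain ⟨x, hx1, hxR⟩ : ∃ x, max 0 (R - min (R / 2) (R ^ 2 / 16)) < x ∧ x < R :=
    exists_between (max_lt hR (sub_lt_self _ (by positivity)))
  have hx : 0 < x := (le_max_left _ _).trans_lt hx1
  have hx2 : R - min (R / 2) (R ^ 2 / 16) < x := (le_max_right _ _).trans_lt hx1
  have hm1 := min_le_left (R / 2) (R ^ 2 / 16)
  have hm2 := min_le_right (R / 2) (R ^ 2 / 16)
  obtain ⟨s, ⟨_, L, hL⟩, hxs⟩ := exists_lt_of_lt_csSup ⟨r, hrS⟩ hxR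
  have hy : x + x ^ 2 / 2 ∈ S := ⟨by positivity, bounded_of_coeff_rhsTrunc hb hrec hx hxs hL⟩
  have := le_csSup hbdd hy
  nlinarith

open Filter Topology Asymptotics

theorem Polynomial.coeff_eq_zero_of_isBigO {p : ℝ[X]} {N : ℕ}
    (h : (fun x => p.eval x) =O[𝓝 0] fun x : ℝ => x ^ N) : ∀ k < N, p.coeff k = 0 := by
  intro k
  induction k using Nat.strong_induction_on with
  | _ k ih =>
  intro hk
  obtain ⟨q, rfl⟩ := X_pow_dvd_iff.2 fun d hd => ih d hd (hd.trans hk)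
  have hq : (fun x => q.eval x) =O[𝓝[≠] 0] fun x : ℝ => x ^ (N - k) := by
    obtain ⟨K, hK⟩ := (h.mono (nhdsWithin_le_nhds (s := {0}ᶜ))).bound
    refine IsBigO.of_bound K ?_
    filter_upwards [hK, self_mem_nhdsWithin] with x hx hx0
    have hx0 : 0 < ‖x‖ ^ k := pow_pos (norm_pos_iff.2 hx0) k
    rw [← Nat.sub_add_cancel hk.le] at hx
    simp only [eval_mul, eval_pow, eval_X, norm_mul, norm_pow, pow_add] at hx ⊢
    exact le_of_mul_le_mul_left (by linarith) hx0
  have hlim : Tendsto (fun x : ℝ => x ^ (N - k)) (𝓝[≠] 0) (𝓝 0) := by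
    have : ContinuousAt (fun x : ℝ => x ^ (N - k)) 0 := by fun_prop
    have := this.tendsto.mono_left (nhdsWithin_le_nhds (s := {0}ᶜ))
    rwa [zero_pow (by omega)] at this
  have h0 := tendsto_nhds_unique (hq.trans_tendsto hlim)
    (q.continuous.continuousAt.tendsto.mono_left nhdsWithin_le_nhds)
  rw [coeff_X_pow_mul', if_pos le_rfl, Nat.sub_self, coeff_zero_eq_eval_zero]
  exact h0.symm

theorem AnalyticAt.isBigO_sub_taylor {f : ℝ → ℝ} (hf : AnalyticAt ℝ f 0) (N : ℕ) :
    (fun x => f x - ∑ n ∈ Finset.range N, iteratedDeriv n f 0 / n.factorial * x ^ n)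
      =O[𝓝 0] fun x : ℝ => x ^ N := by
  have h := hf.hasFPowerSeriesAt.isBigO_sub_partialSum_pow N
  simp only [← norm_pow] at h
  simpa [FormalMultilinearSeries.partialSum, FormalMultilinearSeries.ofScalars_apply_eq, mul_comm]
    using h.of_norm_right

theorem AnalyticAt.exists_taylor_bound {f : ℝ → ℝ} (hf : AnalyticAt ℝ f 0) :
    ∃ r > 0, ∃ K, ∀ n : ℕ, iteratedDeriv n f 0 / n.factorial * r ^ n ≤ K := by
  have h := hf.hasFPowerSeriesAt
  obtain ⟨r, hr0, hr⟩ := ENNReal.lt_iff_exists_nnreal_btwn.1 h.radius_pos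
  obtain ⟨K, -, hK⟩ := FormalMultilinearSeries.norm_mul_pow_le_of_lt_radius _ hr
  refine ⟨r, by simpa using hr0, K, fun n => le_trans ?_ (hK n)⟩
  gcongr
  rw [FormalMultilinearSeries.ofScalars_norm]
  exact le_abs_self _

theorem Asymptotics.IsBigO.mul_sub_mul {f p g q h : ℝ → ℝ} (hfp : (fun x => f x - p x) =O[𝓝 0] h)
    (hgq : (fun x => g x - q x) =O[𝓝 0] h) (hf : ContinuousAt f 0) (hq : ContinuousAt q 0) :
    (fun x => f x * g x - p x * q x) =O[𝓝 0] h := by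
  have h1 := (hf.isBigO_one ℝ).mul hgq
  have h2 := hfp.mul (hq.isBigO_one ℝ)
  simp only [one_mul, mul_one] at h1 h2
  exact (h1.add h2).congr_left fun x => by ring

/-- The Taylor coefficients of `g'` satisfy the recursion coming from `g'' = g'² · (g' ∘ g)`. -/
theorem coeff_rhsTrunc_of_deriv_deriv_eq {g : ℝ → ℝ} (hg : AnalyticAt ℝ g 0) (h0 : g 0 = 0)
    (h : deriv (deriv g) =ᶠ[𝓝 0] fun x => deriv g x ^ 2 * deriv g (g x)) (N k : ℕ) (hk : k < N) :
    (rhsTrunc (fun n => iteratedDeriv n (deriv g) 0 / n.factorial) N).coeff k =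
      (k + 1) * (iteratedDeriv (k + 1) (deriv g) 0 / (k + 1).factorial) := by
  set b : ℕ → ℝ := fun n => iteratedDeriv n (deriv g) 0 / n.factorial
  change _ = (k + 1) * b (k + 1)
  have hu := hg.deriv
  have hO1 : (fun x => deriv g x - (seriesTrunc b N).eval x) =O[𝓝 0] fun x : ℝ => x ^ N := by
    simpa only [eval_seriesTrunc] using hu.isBigO_sub_taylor N
  have hO2 : (fun x => g x - (primTrunc b N).eval x) =O[𝓝 0] fun x : ℝ => x ^ N := by
    have h1 := hg.isBigO_sub_taylor (N + 1)
    have h2 : (fun x : ℝ => x ^ (N + 1)) =O[𝓝 0] fun x : ℝ => x ^ N := by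
      simpa [pow_succ'] using (continuousAt_id.isBigO_one ℝ).mul
        (isBigO_refl (fun x : ℝ => x ^ N) (𝓝 0))
    refine (h1.trans h2).congr_left fun x => ?_
    rw [eval_primTrunc, Finset.sum_range_succ']
    simp only [iteratedDeriv_zero, h0, iteratedDeriv_succ', Nat.factorial_succ, b]
    push_cast
    simp only [zero_div, zero_mul, add_zero]
    congr 1
    refine Finset.sum_congr rfl fun n _ => ?_
    field_simp
  have hO3 : (fun x => deriv (deriv g) x - (∑ k ∈ Finset.range N, C ((k + 1) * b (k + 1)) * X ^ k :
      ℝ[X]).eval x) =O[𝓝 0] fun x : ℝ => x ^ N := by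
    refine (hu.deriv.isBigO_sub_taylor N).congr_left fun x => ?_
    simp only [eval_finsetSum, eval_mul, eval_C, eval_pow, eval_X, b]
    congr 1
    refine Finset.sum_congr rfl fun n _ => ?_
    rw [iteratedDeriv_succ', Nat.factorial_succ]
    push_cast
    field_simp
  have hgt : Tendsto g (𝓝 0) (𝓝 0) := by simpa [h0] using hg.continuousAt.tendsto
  have hPt : Tendsto (fun x => (primTrunc b N).eval x) (𝓝 0) (𝓝 0) := by
    have := (primTrunc b N).continuous.tendsto 0
    rwa [← coeff_zero_eq_eval_zero, coeff_primTrunc_zero] at this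
  have hgO : g =O[𝓝 0] fun x : ℝ => x := by
    simpa [h0] using hg.differentiableAt.isBigO_sub
  have hO4 : (fun x => deriv g (g x) - ((seriesTrunc b N).comp (primTrunc b N)).eval x)
      =O[𝓝 0] fun x : ℝ => x ^ N := by
    have h1 := (hO1.comp_tendsto hgt).trans (hgO.pow N)
    have h2 := ((seriesTrunc b N).hasStrictDerivAt 0).isBigO_sub.comp_tendsto
      (hgt.prodMk_nhds hPt)
    refine (h1.add (h2.trans hO2)).congr_left fun x => ?_
    simp [eval_comp]
  have hO5 : (fun x => deriv g x ^ 2 * deriv g (g x) - (rhsTrunc b N).eval x)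
      =O[𝓝 0] fun x : ℝ => x ^ N := by
    simp only [rhsTrunc, eval_mul, sq]
    exact (hO1.mul_sub_mul hO1 hu.continuousAt (Polynomial.continuous _).continuousAt).mul_sub_mul
      hO4 (hu.continuousAt.mul hu.continuousAt) (Polynomial.continuous _).continuousAt
  have hO6 : (fun x => (rhsTrunc b N - ∑ k ∈ Finset.range N, C ((k + 1) * b (k + 1)) * X ^ k :
      ℝ[X]).eval x) =O[𝓝 0] fun x : ℝ => x ^ N := by
    refine (hO3.sub hO5).congr' ?_ EventuallyEq.rfl
    filter_upwards [h] with x hx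
    rw [hx, eval_sub]
    ring
  have := Polynomial.coeff_eq_zero_of_isBigO hO6 k hk
  rw [coeff_sub, sub_eq_zero] at this
  rw [this, finsetSum_coeff]
  simp only [coeff_C_mul_X_pow]
  simp [hk]

/-- There is no function `g` with `g 0 = 0`, real analytic at `0` (i.e. whose Taylor series at
`0` has positive radius of convergence), satisfying `g' t = exp (g (g t))` on a right
neighborhood `[0, ε)` of `0`. -/
theorem stmt_6 :
    ¬ ∃ (g : ℝ → ℝ) (ε : ℝ), 0 < ε ∧ AnalyticAt ℝ g 0 ∧ g 0 = 0 ∧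
      ∀ t ∈ Set.Ico (0 : ℝ) ε, HasDerivWithinAt g (Real.exp (g (g t))) (Set.Ici 0) t := by
  rintro ⟨g, ε, hε, hg, h0, hd⟩
  have hgg : AnalyticAt ℝ (fun x => g (g x)) 0 := hg.comp_of_eq hg h0
  have hfreq : ∃ᶠ x in 𝓝[≠] (0 : ℝ), deriv g x = Real.exp (g (g x)) := by
    have : ∀ᶠ x in 𝓝[>] (0 : ℝ), deriv g x = Real.exp (g (g x)) := by
      filter_upwards [Ioo_mem_nhdsGT hε] with x hx
      exact ((hd x ⟨hx.1.le, hx.2⟩).hasDerivAt (Ici_mem_nhds hx.1)).deriv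
    exact this.frequently.filter_mono (nhdsWithin_mono _ fun x hx => ne_of_gt hx)
  have hev : deriv g =ᶠ[𝓝 0] fun x => Real.exp (g (g x)) :=
    (hg.deriv.frequently_eq_iff_eventually_eq hgg.rexp).1 hfreq
  have hgt : Tendsto g (𝓝 0) (𝓝 0) := by simpa [h0] using hg.continuousAt.tendsto
  have hdiff : ∀ᶠ x in 𝓝 0, DifferentiableAt ℝ g x :=
    hg.eventually_analyticAt.mono fun x hx => hx.differentiableAt
  have h2 : deriv (deriv g) =ᶠ[𝓝 0] fun x => deriv g x ^ 2 * deriv g (g x) := by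
    filter_upwards [hev.deriv, hev, hdiff, hgt.eventually hdiff] with x hx1 hx2 hx3 hx4
    have := (hx4.hasDerivAt.comp x hx3.hasDerivAt).exp.deriv
    rw [hx1]
    refine this.trans ?_
    rw [Function.comp_apply, ← hx2]
    ring
  obtain ⟨r, hr, K, hK⟩ := hg.deriv.exists_taylor_bound
  refine not_bounded_of_coeff_rhsTrunc
    (b := fun n => iteratedDeriv n (deriv g) 0 / n.factorial) ?_
    (coeff_rhsTrunc_of_deriv_deriv_eq hg h0 h2) hr K hK
  simp [hev.eq_of_nhds, h0]
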